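/- Let e = R_{e₁,e₋₂} + R_{e₂,e₀} ∈ so(V, β) (a nilpotent element of Jordan type (5,1²)). Then the centralizer of e in so(V, β) equals the ℂ-span of {e, R_{e₁,e₋₃}, R_{e₃,e₋₃}, R_{e₁,e₃}, R_{e₁,e₂}}; in particular it has dimension 5 over ℂ. -/

import Mathlib

noncomputable section

/-- `V = ℂ⁷` with ordered basis `(e₁, e₂, e₃, e₀, e₋₃, e₋₂, e₋₁)`. -/
abbrev V7 : Type := Fin 7 → ℂ

/-- The Gram matrix of the symmetric bilinear form `β` in the ordered basis
`(e₁, e₂, e₃, e₀, e₋₃, e₋₂, e₋₁)`:  `β(eᵢ, e₋ᵢ) = β(e₋ᵢ, eᵢ) = 1`, `β(e₀,e₀) = 2`,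
all other pairs `0`. -/
def Bmat : Matrix (Fin 7) (Fin 7) ℂ :=
  Matrix.of fun i j =>
    if (i : ℕ) + (j : ℕ) = 6 then (if (i : ℕ) = 3 then 2 else 1) else 0

/-- The symmetric bilinear form `β` on `V`. -/
def beta : V7 →ₗ[ℂ] V7 →ₗ[ℂ] ℂ := Matrix.toBilin' Bmat

/-- `so(V, β) = {x ∈ End(V) : β(xu, w) + β(u, xw) = 0 for all u, w}`. -/
def so7 : Set (Module.End ℂ V7) :=
  {x | ∀ u w : V7, beta (x u) w + beta u (x w) = 0}

/-- `R_{u,w}(v) = β(w,v) • u − β(u,v) • w`. -/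
def Rm (u w : V7) : Module.End ℂ V7 :=
  (beta w).smulRight u - (beta u).smulRight w

def e1 : V7 := Pi.single 0 1
def e2 : V7 := Pi.single 1 1
def e3 : V7 := Pi.single 2 1
def e0 : V7 := Pi.single 3 1
def em3 : V7 := Pi.single 4 1
def em2 : V7 := Pi.single 5 1
def em1 : V7 := Pi.single 6 1

/-- The nilpotent element . -/
def eNil : Module.End ℂ V7 := Rm e1 em2 + Rm e2 e0

/-- The centralizer of  in . -/
def cent : Set (Module.End ℂ V7) := {x | x ∈ so7 ∧ x * eNil = eNil * x}

/-- The claimed spanning set. -/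
def spanSet : Set (Module.End ℂ V7) := {eNil, Rm e1 em3, Rm e3 em3, Rm e1 e3, Rm e1 e2}

theorem beta_apply (u w : V7) :
    beta u w = u 0 * w 6 + u 1 * w 5 + u 2 * w 4 + 2 * u 3 * w 3 + u 4 * w 2 + u 5 * w 1
      + u 6 * w 0 := by
  simp [beta, Matrix.toBilin'_apply, Bmat, Fin.sum_univ_succ, Fin.succ]
  ring

theorem Rm_apply (u w v : V7) : Rm u w v = beta w v • u - beta u v • w := rfl

theorem eNil_apply (v : V7) : eNil v = ![v 1, 2 * v 3, 0, -v 5, 0, -v 6, 0] := by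
  ext i
  fin_cases i <;> simp [eNil, Rm_apply, beta_apply, e1, e2, e0, em2]

/-- The members of `spanSet`, as a family. -/
def generator : Fin 5 → Module.End ℂ V7 :=
  ![eNil, Rm e1 em3, Rm e3 em3, Rm e1 e3, Rm e1 e2]

theorem range_generator : Set.range generator = spanSet := by
  ext
  simp [generator, spanSet]
  tauto

theorem sum_generator_apply (c : Fin 5 → ℂ) (v : V7) :
    (∑ i, c i • generator i) v =
      ![c 0 * v 1 + c 1 * v 2 + c 3 * v 4 + c 4 * v 5, 2 * c 0 * v 3 - c 4 * v 6,
        c 2 * v 2 - c 3 * v 6, -(c 0 * v 5), -(c 1 * v 6) - c 2 * v 4, -(c 0 * v 6), 0] := by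
  ext k
  simp only [Fin.sum_univ_five, generator, LinearMap.add_apply, LinearMap.smul_apply,
    Matrix.cons_val, eNil_apply, Rm_apply, beta_apply, Pi.add_apply, Pi.smul_apply,
    Pi.sub_apply]
  fin_cases k <;> simp [e1, e2, e3, em3] <;> ring

theorem linearIndependent_generator : LinearIndependent ℂ generator := by
  rw [Fintype.linearIndependent_iff]
  intro c hc
  have h (v : V7) (k : Fin 7) := congrFun (sum_generator_apply c v) k
  simp only [hc, LinearMap.zero_apply, Pi.zero_apply] at h
  have h₀ := h e2 0
  have h₁ := h e3 0
  have h₂ := h e3 2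
  have h₃ := h em3 0
  have h₄ := h em2 0
  simp [e2, e3, em3, em2] at h₀ h₁ h₂ h₃ h₄
  intro i
  fin_cases i <;> simp [← h₀, ← h₁, ← h₂, ← h₃, ← h₄]

theorem sum_generator_mem_cent (c : Fin 5 → ℂ) : ∑ i, c i • generator i ∈ cent := by
  refine ⟨fun u w => ?_, LinearMap.ext fun v => ?_⟩
  · simp only [sum_generator_apply, beta_apply, Matrix.cons_val]
    ring
  · simp only [Module.End.mul_apply, sum_generator_apply, eNil_apply, Matrix.cons_val]
    ext i
    fin_cases i <;> simp <;> ring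

theorem eq_sum_generator_of_mem_cent {x : Module.End ℂ V7} (hx : x ∈ cent) :
    x = ∑ i, ![x e2 0, x e3 0, x e3 2, x em3 0, x em2 0] i • generator i := by
  obtain ⟨hso, hcomm⟩ := hx
  have skew (i j : Fin 7) := hso (Pi.single i 1) (Pi.single j 1)
  have comm (v : V7) (k : Fin 7) : x (eNil v) k = eNil (x v) k :=
    congrFun (LinearMap.congr_fun hcomm v) k
  have he₁ : eNil e1 = 0 := by ext i; fin_cases i <;> simp [eNil_apply, e1]
  have he₂ : eNil e2 = e1 := by ext i; fin_cases i <;> simp [eNil_apply, e2, e1]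
  have he₃ : eNil e3 = 0 := by ext i; fin_cases i <;> simp [eNil_apply, e3]
  have he₀ : eNil e0 = (2 : ℂ) • e2 := by ext i; fin_cases i <;> simp [eNil_apply, e0, e2]
  have hem₃ : eNil em3 = 0 := by ext i; fin_cases i <;> simp [eNil_apply, em3]
  have hem₂ : eNil em2 = -e0 := by ext i; fin_cases i <;> simp [eNil_apply, em2, e0]
  have hem₁ : eNil em1 = -em2 := by ext i; fin_cases i <;> simp [eNil_apply, em1, em2]
  have comm₁ := comm e1
  have comm₂ := comm e2
  have comm₃ := comm e3
  have comm₀ := comm e0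
  have comm₄ := comm em3
  have comm₅ := comm em2
  have comm₆ := comm em1
  clear comm hcomm hso
  simp only [he₁, he₂, he₃, he₀, hem₃, hem₂, hem₁]
    at comm₁ comm₂ comm₃ comm₀ comm₄ comm₅ comm₆
  clear he₁ he₂ he₃ he₀ hem₃ hem₂ hem₁
  apply LinearMap.pi_ext'
  intro j
  ext k
  simp only [LinearMap.comp_apply, LinearMap.single_apply, sum_generator_apply]
  simp only [e1, e2, e3, e0, em3, em2, em1, eNil_apply, map_zero, map_neg, map_smul] at *
  generalize hy : (fun i : Fin 7 => x (Pi.single i 1)) = y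
  replace hy (i : Fin 7) : x (Pi.single i 1) = y i := congrFun hy i
  simp only [hy] at *
  clear hy x
  simp [Fin.forall_fin_succ, Fin.succ, beta_apply] at *
  fin_cases j <;> fin_cases k <;> simp <;> grind

theorem statement2 :
    cent = ↑(Submodule.span ℂ spanSet) ∧
      Module.finrank ℂ ↥(Submodule.span ℂ spanSet) = 5 := by
  rw [← range_generator]
  refine ⟨Set.ext fun x => ?_, by simp [finrank_span_eq_card linearIndependent_generator]⟩
  rw [SetLike.mem_coe, Submodule.mem_span_range_iff_exists_fun]
  exact ⟨fun hx => ⟨_, (eq_sum_generator_of_mem_cent hx).symm⟩,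
    fun ⟨c, hc⟩ => hc ▸ sum_generator_mem_cent c⟩
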